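/- The Gray graph is edge-transitive: for any two edges {a,b} and {c,d} of the Gray graph there exists a graph automorphism φ of the Gray graph such that {φ(a), φ(b)} = {c, d}. -/

import Mathlib

def lcfD (x : ZMod 6) : ℤ :=
  if x = 0 then 7 else if x = 1 then -7 else if x = 2 then 13
  else if x = 3 then -13 else if x = 4 then 25 else -25

def grayGraph : SimpleGraph (ZMod 54) :=
  SimpleGraph.fromRel (fun u v => v = u + 1 ∨ v = u + ((lcfD ((u.val : ZMod 6))) : ZMod 54))

instance : DecidableRel grayGraph.Adj := fun u v =>
  decidable_of_iff _ (SimpleGraph.fromRel_adj _ u v).symm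

namespace SimpleGraph

variable {V : Type*} (G : SimpleGraph V)

/-- The map `f` underlies an automorphism of `G`. -/
def IsAutomorphism (f : V → V) : Prop :=
  ∃ φ : G ≃g G, ⇑φ = f

variable {G} {f g : V → V}

theorem IsAutomorphism.comp (hf : G.IsAutomorphism f) (hg : G.IsAutomorphism g) :
    G.IsAutomorphism (f ∘ g) := by
  obtain ⟨φ, rfl⟩ := hf
  obtain ⟨ψ, rfl⟩ := hg
  exact ⟨ψ.trans φ, rfl⟩

theorem IsAutomorphism.iterate (hf : G.IsAutomorphism f) (n : ℕ) :
    G.IsAutomorphism f^[n] := by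
  induction n with
  | zero => exact ⟨Iso.refl, rfl⟩
  | succ n ih => exact ih.comp hf

/-- An adjacency-preserving map of finite order is an automorphism. -/
theorem isAutomorphism_of_iterate_eq {n : ℕ} (hadj : ∀ u v, G.Adj u v → G.Adj (f u) (f v))
    (hf : ∀ x, f^[n + 1] x = x) : G.IsAutomorphism f := by
  have hadj' (k : ℕ) : ∀ u v, G.Adj u v → G.Adj (f^[k] u) (f^[k] v) := by
    induction k with
    | zero => exact fun _ _ h => h
    | succ k ih => exact fun u v h => ih _ _ (hadj u v h)
  refine ⟨⟨⟨f, f^[n], hf, fun x => ?_⟩, fun {u v} => ⟨fun h => ?_, hadj u v⟩⟩, rfl⟩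
  · rw [← Function.iterate_succ_apply' f n x, hf]
  · simpa only [← Function.iterate_succ_apply, hf] using hadj' n (f u) (f v) h

end SimpleGraph

namespace GrayGraph

/-- The rotation of order nine visible in the LCF notation. -/
def rotation (x : ZMod 54) : ZMod 54 := x + 6

/-- An automorphism of order three that permutes the three classes of even vertices modulo `6`. -/
def evenShift (x : ZMod 54) : ZMod 54 :=
  x + (18 * ((x.val + 1) / 6) + if (x.val + 1) % 6 < 4 then 4 else 10 : ℕ)

/-- An automorphism of order three that fixes `0` and cyclically permutes its neighbours
`1`, `7` and `53`. -/
def neighborCycle (x : ZMod 54) : ZMod 54 :=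
  x + ([0, 6, 4, 2, 0, 24, 22, -8, -10, -12, -26, -26, 14, 14, 0, -2, -4, 2].getD
    (x.val % 18) 0 : ℤ)

theorem isAutomorphism_rotation : grayGraph.IsAutomorphism rotation :=
  SimpleGraph.isAutomorphism_of_iterate_eq (n := 8) (by decide +kernel) (by decide +kernel)

theorem isAutomorphism_evenShift : grayGraph.IsAutomorphism evenShift :=
  SimpleGraph.isAutomorphism_of_iterate_eq (n := 2) (by decide +kernel) (by decide +kernel)

theorem isAutomorphism_neighborCycle : grayGraph.IsAutomorphism neighborCycle :=
  SimpleGraph.isAutomorphism_of_iterate_eq (n := 2) (by decide +kernel) (by decide +kernel)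

/-- The automorphism carrying the edge `{0, 1}` to an arbitrary edge, for suitable exponents. -/
def edgeMover (i : Fin 9) (j k : Fin 3) : ZMod 54 → ZMod 54 :=
  rotation^[i] ∘ evenShift^[j] ∘ neighborCycle^[k]

theorem isAutomorphism_edgeMover (i : Fin 9) (j k : Fin 3) :
    grayGraph.IsAutomorphism (edgeMover i j k) :=
  (isAutomorphism_rotation.iterate i).comp
    ((isAutomorphism_evenShift.iterate j).comp (isAutomorphism_neighborCycle.iterate k))

theorem exists_edgeMover_eq : ∀ a b : ZMod 54, grayGraph.Adj a b → ∃ i j k,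
    (edgeMover i j k 0 = a ∧ edgeMover i j k 1 = b) ∨
      (edgeMover i j k 0 = b ∧ edgeMover i j k 1 = a) := by
  decide +kernel

/-- Every edge is the image of the edge `{0, 1}` under an automorphism. -/
theorem exists_iso_of_adj {a b : ZMod 54} (h : grayGraph.Adj a b) :
    ∃ φ : grayGraph ≃g grayGraph, (φ 0 = a ∧ φ 1 = b) ∨ (φ 0 = b ∧ φ 1 = a) := by
  obtain ⟨i, j, k, hijk⟩ := exists_edgeMover_eq a b h
  obtain ⟨φ, hφ⟩ := isAutomorphism_edgeMover i j k
  exact ⟨φ, hφ ▸ hijk⟩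

end GrayGraph

theorem gray_graph_edge_transitive :
    ∀ a b c d : ZMod 54, grayGraph.Adj a b → grayGraph.Adj c d →
      ∃ φ : grayGraph ≃g grayGraph, (φ a = c ∧ φ b = d) ∨ (φ a = d ∧ φ b = c) := by
  intro a b c d hab hcd
  obtain ⟨φ, hφ⟩ := GrayGraph.exists_iso_of_adj hab
  obtain ⟨ψ, hψ⟩ := GrayGraph.exists_iso_of_adj hcd
  refine ⟨φ.symm.trans ψ, ?_⟩
  rcases hφ with ⟨rfl, rfl⟩ | ⟨rfl, rfl⟩ <;> rcases hψ with ⟨rfl, rfl⟩ | ⟨rfl, rfl⟩ <;> simp
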